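/- arXiv:2208.04005 — 2 statements merged into one kernel-verified Lean document; each statement's English description precedes it below -/
import Mathlib

section
/- The summed Lagrange multipliers are symmetric in the continuum indices: for all i, s ∈ {1,…,N}, Σ_{p=1}^P β_{is}^p = Σ_{p=1}^P β_{si}^p. (Both sides equal the symmetric quantity ∫_{R⁺} κ ∇φ_i · ∇φ_s = ∫_{R⁺} κ ∇φ_s · ∇φ_i, obtained by testing the cell problem for φ_i with v = φ_s and the cell problem for φ_s with v = φ_i.) -/
open MeasureTheory

/-- Product of gradients weighted by κ: `κ(x) ∇f(x) · ∇g(x)`. -/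
noncomputable def gradDot (d : ℕ) (κ f g : (Fin d → ℝ) → ℝ) (x : Fin d → ℝ) : ℝ :=
  κ x * ∑ m : Fin d, fderiv ℝ f x (Pi.single m 1) * fderiv ℝ g x (Pi.single m 1)

theorem gradDot_comm (d : ℕ) (κ f g : (Fin d → ℝ) → ℝ) : gradDot d κ f g = gradDot d κ g f := by
  funext x
  simp only [gradDot, mul_comm]

/-- Symmetry of the summed Lagrange multipliers: ∑_p β_{is}^p = ∑_p β_{si}^p. -/
theorem stmt_3
    (d N P : ℕ) (hd : 0 < d) (hN : 0 < N) (hP : 0 < P)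
    (Rplus : Set (Fin d → ℝ)) (Rp : Fin P → Set (Fin d → ℝ))
    (hRplusMeas : MeasurableSet Rplus) (hRpMeas : ∀ p, MeasurableSet (Rp p))
    (hRpSub : ∀ p, Rp p ⊆ Rplus)
    (κ : (Fin d → ℝ) → ℝ) (hκ : Measurable κ)
    (ψ : Fin N → Fin P → (Fin d → ℝ) → ℝ)
    (hψint : ∀ j p, IntegrableOn (ψ j p) (Rp p))
    (hψne : ∀ j p, (∫ x in Rp p, ψ j p x) ≠ 0)
    (φ : Fin N → (Fin d → ℝ) → ℝ)
    (hφ : ∀ i, ContDiff ℝ 1 (φ i))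
    (β : Fin N → Fin N → Fin P → ℝ)
    (hcell : ∀ (i : Fin N) (v : (Fin d → ℝ) → ℝ), ContDiff ℝ 1 v →
      IntegrableOn (gradDot d κ (φ i) v) Rplus →
      (∀ j p, IntegrableOn (fun x => ψ j p x * v x) (Rp p)) →
      (∫ x in Rplus, gradDot d κ (φ i) v x)
        = ∑ j : Fin N, ∑ p : Fin P,
            β i j p * (∫ x in Rp p, ψ j p x)⁻¹ * (∫ x in Rp p, ψ j p x * v x))
    (hconstr : ∀ i j p,
      (∫ x in Rp p, φ i x * ψ j p x)
        = (if i = j then (1 : ℝ) else 0) * ∫ x in Rp p, ψ j p x)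
    (hgradInt : ∀ i s, IntegrableOn (gradDot d κ (φ i) (φ s)) Rplus)
    (hψφInt : ∀ j p s, IntegrableOn (fun x => ψ j p x * φ s x) (Rp p)) :
    ∀ i s : Fin N, (∑ p : Fin P, β i s p) = ∑ p : Fin P, β s i p := by
  have key : ∀ i s : Fin N, (∫ x in Rplus, gradDot d κ (φ i) (φ s) x) = ∑ p : Fin P, β i s p := by
    intro i s
    rw [hcell i (φ s) (hφ s) (hgradInt i s) (fun j p => hψφInt j p s),
      Finset.sum_eq_single s]
    · refine Finset.sum_congr rfl fun p _ => ?_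
      have h := hconstr s s p
      simp only [mul_comm (φ s _), if_true, one_mul] at h
      rw [h, mul_assoc, inv_mul_cancel₀ (hψne s p), mul_one]
    · intro j _ hj
      refine Finset.sum_eq_zero fun p _ => ?_
      have h := hconstr s j p
      simp only [mul_comm (φ s _), if_neg hj.symm, zero_mul] at h
      rw [h, mul_zero]
    · simp
  intro i s
  rw [← key i s, ← key s i, gradDot_comm]
end

section
/- The first-order Lagrange multipliers of the average-constraint cell problems coincide (up to transposition of continuum indices) with the zeroth-order Lagrange multipliers of the gradient-constraint cell problems: α_{ik}^m = β_{ki}^m for all i, k ∈ {1,…,N} and m ∈ {1,…,d}. (Indeed, α_{ik}^m = ∫_R κ ∇φ_i · ∇φ_k^m and β_{ki}^m = ∫_R κ ∇φ_k^m · ∇φ_i, and the two integrands are equal pointwise.) -/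
open MeasureTheory

/-- The first-order multipliers of the average-constraint cell problems coincide, up to
transposition of the continuum indices, with the zeroth-order multipliers of the
gradient-constraint cell problems: α_{ik}^m = β_{ki}^m. -/
theorem stmt_8
    (d N : ℕ) (hd : 0 < d) (hN : 0 < N)
    (R : Set (Fin d → ℝ)) (hRMeas : MeasurableSet R)
    (κ : (Fin d → ℝ) → ℝ) (hκ : Measurable κ)
    (ψ : Fin N → (Fin d → ℝ) → ℝ)
    (hψint : ∀ j, IntegrableOn (ψ j) R)
    (hψne : ∀ j, (∫ x in R, ψ j x) ≠ 0)
    (φ : Fin N → (Fin d → ℝ) → ℝ)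
    (hφ : ∀ i, ContDiff ℝ 1 (φ i))
    (α : Fin N → Fin N → Fin d → ℝ) (β : Fin N → Fin N → ℝ)
    (hcellA : ∀ (i : Fin N) (v : (Fin d → ℝ) → ℝ), ContDiff ℝ 1 v →
      IntegrableOn (gradDot d κ (φ i) v) R →
      (∀ (j : Fin N) (n : Fin d),
        IntegrableOn (fun x => ψ j x * fderiv ℝ v x (Pi.single n 1)) R) →
      (∀ j : Fin N, IntegrableOn (fun x => ψ j x * v x) R) →
      (∫ x in R, gradDot d κ (φ i) v x)
        = (∑ j : Fin N, ∑ n : Fin d,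
            α i j n * (∫ x in R, ψ j x)⁻¹
              * (∫ x in R, ψ j x * fderiv ℝ v x (Pi.single n 1)))
          + ∑ j : Fin N, β i j * (∫ x in R, ψ j x)⁻¹ * (∫ x in R, ψ j x * v x))
    (hconstrA1 : ∀ i j, (∫ x in R, φ i x * ψ j x)
        = (if i = j then (1 : ℝ) else 0) * ∫ x in R, ψ j x)
    (hconstrA2 : ∀ i j n,
      (∫ x in R, fderiv ℝ (φ i) x (Pi.single n 1) * ψ j x) = 0)
    (φm : Fin N → Fin d → (Fin d → ℝ) → ℝ)
    (hφm : ∀ i m, ContDiff ℝ 1 (φm i m))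
    (αm : Fin N → Fin N → Fin d → Fin d → ℝ) (βm : Fin N → Fin N → Fin d → ℝ)
    (hcellG : ∀ (i : Fin N) (m : Fin d) (v : (Fin d → ℝ) → ℝ), ContDiff ℝ 1 v →
      IntegrableOn (gradDot d κ (φm i m) v) R →
      (∀ (j : Fin N) (n : Fin d),
        IntegrableOn (fun x => ψ j x * fderiv ℝ v x (Pi.single n 1)) R) →
      (∀ j : Fin N, IntegrableOn (fun x => ψ j x * v x) R) →
      (∫ x in R, gradDot d κ (φm i m) v x)
        = (∑ j : Fin N, ∑ n : Fin d,
            αm i j m n * (∫ x in R, ψ j x)⁻¹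
              * (∫ x in R, ψ j x * fderiv ℝ v x (Pi.single n 1)))
          + ∑ j : Fin N, βm i j m * (∫ x in R, ψ j x)⁻¹ * (∫ x in R, ψ j x * v x))
    (hconstrG1 : ∀ i m j n,
      (∫ x in R, fderiv ℝ (φm i m) x (Pi.single n 1) * ψ j x)
        = (if i = j then (1 : ℝ) else 0) * (if m = n then (1 : ℝ) else 0)
            * ∫ x in R, ψ j x)
    (hconstrG2 : ∀ i m j, (∫ x in R, φm i m x * ψ j x) = 0)
    (hgradInt1 : ∀ i k m, IntegrableOn (gradDot d κ (φ i) (φm k m)) R)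
    (hgradInt2 : ∀ k m i, IntegrableOn (gradDot d κ (φm k m) (φ i)) R)
    (hψφmInt : ∀ j k m, IntegrableOn (fun x => ψ j x * φm k m x) R)
    (hψdφmInt : ∀ j k m n,
      IntegrableOn (fun x => ψ j x * fderiv ℝ (φm k m) x (Pi.single n 1)) R)
    (hψφInt : ∀ j i, IntegrableOn (fun x => ψ j x * φ i x) R)
    (hψdφInt : ∀ j i n,
      IntegrableOn (fun x => ψ j x * fderiv ℝ (φ i) x (Pi.single n 1)) R) :
    ∀ (i k : Fin N) (m : Fin d), α i k m = βm k i m := by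
  intro i k m
  have hA := hcellA i (φm k m) (hφm k m) (hgradInt1 i k m) (fun j n => hψdφmInt j k m n)
    (fun j => hψφmInt j k m)
  have hG := hcellG k m (φ i) (hφ i) (hgradInt2 k m i) (fun j n => hψdφInt j i n)
    (fun j => hψφInt j i)
  have hsymm : gradDot d κ (φ i) (φm k m) = gradDot d κ (φm k m) (φ i) := by
    funext x
    simp only [gradDot, mul_comm]
  simp only [mul_comm (ψ _ _), hconstrG1, hconstrG2, mul_zero, Finset.sum_const_zero,
    add_zero] at hA
  simp only [mul_comm (ψ _ _), hconstrA1, hconstrA2, mul_zero, Finset.sum_const_zero,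
    zero_add] at hG
  rw [Finset.sum_eq_single k (by intro j _ hj; simp [hj.symm]) (by simp),
    Finset.sum_eq_single m (by intro n _ hn; simp [hn.symm]) (by simp)] at hA
  rw [Finset.sum_eq_single i (by intro j _ hj; simp [hj.symm]) (by simp)] at hG
  simp only [if_true, one_mul, inv_mul_cancel_right₀ (hψne _)] at hA hG
  rw [← hA, ← hG, hsymm]
end
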